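/- arXiv:2207.04469 — 7 statements merged into one kernel-verified Lean document; each statement's English description precedes it below -/
import Mathlib

section
/- Let n ≥ 1, let R be a commutative ring and let Y_1, …, Y_n, Z_1, …, Z_n ∈ R. Then det_{1 ≤ i, j ≤ n} (Y_i^j − Z_i^j) = Σ_{σ ∈ S_n} sgn(σ) · ∏_{1 ≤ i ≤ j ≤ n} (Y_{σ(j)} − Z_{σ(i)}). -/
/-- Splitting off the smallest index in a product over the pairs `i ≤ j`. -/
theorem Fin.prod_filter_le_succ {M : Type*} [CommMonoid M] (n : ℕ)
    (f : Fin (n + 1) → Fin (n + 1) → M) :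
    ∏ p ∈ Finset.univ.filter (fun p : Fin (n + 1) × Fin (n + 1) => p.1 ≤ p.2), f p.1 p.2 =
      (∏ j, f 0 j) *
        ∏ p ∈ Finset.univ.filter (fun p : Fin n × Fin n => p.1 ≤ p.2), f p.1.succ p.2.succ := by
  simp only [Finset.prod_filter, Fintype.prod_prod_type]
  rw [Fin.prod_univ_succ]
  refine congrArg₂ (· * ·) ?_ ?_
  · simp
  · refine Finset.prod_congr rfl fun i _ => ?_
    rw [Fin.prod_univ_succ]
    simp

/-- A permutation of `Fin (n + 1)` is determined by the image `k` of `0` and by a permutation of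
`Fin n`, transported along `k.succAbove`. -/
theorem Fin.bijective_cycleRange_symm_mul_decomposeFin_symm (n : ℕ) :
    Function.Bijective fun q : Fin (n + 1) × Equiv.Perm (Fin n) =>
      q.1.cycleRange.symm * Equiv.Perm.decomposeFin.symm (0, q.2) := by
  rw [Fintype.bijective_iff_injective_and_card]
  refine ⟨?_, by simp [Fintype.card_perm, Nat.factorial_succ]⟩
  rintro ⟨k, τ⟩ ⟨l, ρ⟩ h
  obtain rfl : k = l := by simpa using DFunLike.congr_fun h 0
  simpa using h

/-- Summation over permutations of `Fin (n + 1)`, organised by the image of `0`. -/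
theorem Fin.sum_perm_succ {M : Type*} [AddCommMonoid M] (n : ℕ)
    (f : Equiv.Perm (Fin (n + 1)) → M) :
    ∑ σ, f σ = ∑ k : Fin (n + 1), ∑ τ : Equiv.Perm (Fin n),
      f (k.cycleRange.symm * Equiv.Perm.decomposeFin.symm (0, τ)) := by
  rw [← (Fin.bijective_cycleRange_symm_mul_decomposeFin_symm n).sum_comp f,
    Fintype.sum_prod_type]

/-- The product `∏ j, (Y j - Z k)` is a combination, with coefficients independent of `k`, of the
differences of powers `Y k ^ (j + 1) - Z k ^ (j + 1)`. -/
theorem exists_prod_sub_eq_sum_pow_sub {R : Type*} [CommRing R] (n : ℕ)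
    (Y Z : Fin (n + 1) → R) :
    ∃ c : Fin (n + 1) → R, c (Fin.last n) = (-1) ^ n ∧
      ∀ k, ∏ j, (Y j - Z k) =
        ∑ j : Fin (n + 1), c j * (Y k ^ ((j : ℕ) + 1) - Z k ^ ((j : ℕ) + 1)) := by
  nontriviality R
  set Q : Polynomial R := ∏ j, (Polynomial.X - Polynomial.C (Y j)) with hQ
  have hmonic : Q.Monic := Polynomial.monic_prod_X_sub_C _ _
  have hdeg : Q.natDegree = n + 1 := by simp [hQ]
  refine ⟨fun j => (-1) ^ n * Q.coeff (j + 1), ?_, fun k => ?_⟩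
  · have : Q.coeff (n + 1) = 1 := hdeg ▸ hmonic.coeff_natDegree
    simp [this]
  · have eval_eq (x : R) :
        Q.eval x = ∑ j : Fin (n + 1), Q.coeff (j + 1) * x ^ ((j : ℕ) + 1) + Q.coeff 0 := by
      rw [Polynomial.eval_eq_sum_range, hdeg, Finset.sum_range_succ', Finset.sum_range]
      simp
    have hY : Q.eval (Y k) = 0 := by
      rw [hQ, Polynomial.eval_prod]
      exact Finset.prod_eq_zero (Finset.mem_univ k) (by simp)
    have hZ : ∏ j, (Y j - Z k) = (-1) ^ (n + 1) * Q.eval (Z k) := by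
      rw [hQ, Polynomial.eval_prod]
      calc ∏ j, (Y j - Z k) = ∏ j, (-1) * (Z k - Y j) := by simp
        _ = _ := by rw [Finset.prod_mul_distrib]; simp
    rw [hZ, ← sub_zero (Q.eval (Z k)), ← hY, eval_eq, eval_eq]
    simp only [mul_sub, Finset.sum_sub_distrib, mul_assoc, ← Finset.mul_sum]
    ring

/-- **Lemma (antisymmetrizer formula).**
For `n ≥ 1`, a commutative ring `R` and `Y_1, …, Y_n, Z_1, …, Z_n ∈ R`,
`det_{1 ≤ i,j ≤ n} (Y_i^j − Z_i^j) = Σ_{σ ∈ S_n} sgn σ · ∏_{1 ≤ i ≤ j ≤ n} (Y_{σ(j)} − Z_{σ(i)})`. -/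
theorem det_pow_sub_eq_antisymmetrizer {R : Type*} [CommRing R] (n : ℕ) (hn : 1 ≤ n)
    (Y Z : Fin n → R) :
    (Matrix.of fun i j : Fin n => Y i ^ ((j : ℕ) + 1) - Z i ^ ((j : ℕ) + 1)).det =
      ∑ σ : Equiv.Perm (Fin n),
        ((Equiv.Perm.sign σ : ℤ) : R) *
          ∏ p ∈ Finset.univ.filter (fun p : Fin n × Fin n => p.1 ≤ p.2),
            (Y (σ p.2) - Z (σ p.1)) := by
  clear hn
  induction n with
  | zero => simp
  | succ n ih =>
    obtain ⟨c, hc, hcol⟩ := exists_prod_sub_eq_sum_pow_sub n Y Z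
    set M : Matrix (Fin (n + 1)) (Fin (n + 1)) R :=
      Matrix.of fun i j => Y i ^ ((j : ℕ) + 1) - Z i ^ ((j : ℕ) + 1) with hM
    have hdet : (M.updateCol (Fin.last n) fun k => ∏ j, (Y j - Z k)).det = (-1) ^ n * M.det := by
      have := Matrix.det_updateCol_sum M (Fin.last n) c
      rw [hc] at this
      simpa [hcol, hM] using this
    have hminor (k : Fin (n + 1)) :
        ((M.updateCol (Fin.last n) fun k => ∏ j, (Y j - Z k)).submatrix k.succAbove
          (Fin.last n).succAbove).det = ∑ τ : Equiv.Perm (Fin n),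
            ((Equiv.Perm.sign τ : ℤ) : R) *
              ∏ p ∈ Finset.univ.filter (fun p : Fin n × Fin n => p.1 ≤ p.2),
                (Y (k.succAbove (τ p.2)) - Z (k.succAbove (τ p.1))) := by
      rw [Matrix.submatrix_updateCol_succAbove, ← ih (fun i => Y (k.succAbove i)) fun i => Z (k.succAbove i)]
      congr 1
      ext i j
      simp [hM]
    have hsq : (-1 : R) ^ n * (-1) ^ n = 1 := by rw [← mul_pow]; simp
    calc M.det = (-1) ^ n * ((-1) ^ n * M.det) := by rw [← mul_assoc, hsq, one_mul]
      _ = _ := by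
        rw [← hdet, Matrix.det_succ_column _ (Fin.last n), Fin.sum_perm_succ, Finset.mul_sum]
        refine Finset.sum_congr rfl fun k _ => ?_
        rw [hminor, Finset.mul_sum, Finset.mul_sum]
        refine Finset.sum_congr rfl fun τ _ => ?_
        set σ := k.cycleRange.symm * Equiv.Perm.decomposeFin.symm (0, τ) with hσ
        have hσ0 : σ 0 = k := by simp [hσ]
        have hσs (i : Fin n) : σ i.succ = k.succAbove (τ i) := by simp [hσ]
        have hsign : ((Equiv.Perm.sign σ : ℤ) : R) =
            (-1) ^ (k : ℕ) * ((Equiv.Perm.sign τ : ℤ) : R) := by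
          simp [hσ, Fin.sign_cycleRange]
        rw [Fin.prod_filter_le_succ n fun i j => Y (σ j) - Z (σ i), hsign, hσ0,
          Equiv.prod_comp σ fun j => Y j - Z k]
        simp only [hσs, Matrix.updateCol_self, Fin.val_last, pow_add]
        linear_combination (-1 : R) ^ (k : ℕ) * (∏ j, (Y j - Z k)) *
          (((Equiv.Perm.sign τ : ℤ) : R) *
            ∏ p ∈ Finset.univ.filter (fun p : Fin n × Fin n => p.1 ≤ p.2),
              (Y (k.succAbove (τ p.2)) - Z (k.succAbove (τ p.1)))) * hsq
end

section
/- For every n ≥ 1, the following identity holds in F: det_{1 ≤ i, j ≤ n} ( (u²X_i² + u w X_i)^j − (v²X_i^{−2} + v w X_i^{−1})^j ) = ∏_{i=1}^{n} (u X_i − v X_i^{−1}) · ∏_{1 ≤ i < j ≤ n} (X_j − X_i)(u − v X_i^{−1} X_j^{−1}) · det_{1 ≤ i, j ≤ n} ( Σ_{k=j}^{2j} binom(j, k−j) · w^{2j−k} · h_{k−i}(u X_1, v X_1^{−1}, u X_2, v X_2^{−1}, …, u X_i, v X_i^{−1}) ), where the (i, j)-entry of the last matrix involves the complete homogeneous symmetric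 polynomial in the 2i quantities u X_1, v X_1^{−1}, …, u X_i, v X_i^{−1}. -/
noncomputable section

/-- Complete homogeneous symmetric polynomial of degree `m` evaluated at the list `l`. -/
def hpow {R : Type*} [CommSemiring R] : ℕ → List R → R
  | 0, _ => 1
  | _ + 1, [] => 0
  | m + 1, x :: xs => hpow (m + 1) xs + x * hpow m (x :: xs)
  termination_by m l => m + l.length

/-- `h_m` with integer degree: zero for negative degrees. -/
def hz {R : Type*} [CommSemiring R] (m : ℤ) (l : List R) : R :=
  if m < 0 then 0 else hpow m.toNat l

/-- Elementary symmetric polynomial of degree `m` evaluated at the list `l`;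
zero for `m` larger than the length of `l`. -/
def epow {R : Type*} [CommSemiring R] : ℕ → List R → R
  | 0, _ => 1
  | _ + 1, [] => 0
  | m + 1, x :: xs => epow (m + 1) xs + x * epow m xs

/-- `e_m` with integer degree: zero for negative degrees. -/
def ez {R : Type*} [CommSemiring R] (m : ℤ) (l : List R) : R :=
  if m < 0 then 0 else epow m.toNat l

/-- The field `F = ℚ(u, v, w, X_1, …, X_n)` of rational functions. -/
abbrev Fld (n : ℕ) : Type := FractionRing (MvPolynomial (Fin n ⊕ Fin 3) ℚ)

/-- The indeterminate `u`. -/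
def uu (n : ℕ) : Fld n :=
  algebraMap (MvPolynomial (Fin n ⊕ Fin 3) ℚ) (Fld n) (MvPolynomial.X (Sum.inr 0))

/-- The indeterminate `v`. -/
def vv (n : ℕ) : Fld n :=
  algebraMap (MvPolynomial (Fin n ⊕ Fin 3) ℚ) (Fld n) (MvPolynomial.X (Sum.inr 1))

/-- The indeterminate `w`. -/
def wP (n : ℕ) : Fld n :=
  algebraMap (MvPolynomial (Fin n ⊕ Fin 3) ℚ) (Fld n) (MvPolynomial.X (Sum.inr 2))

/-- The indeterminate `X_i` (here `i : Fin n` corresponds to `X_{i+1}`). -/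
def XP {n : ℕ} (i : Fin n) : Fld n :=
  algebraMap (MvPolynomial (Fin n ⊕ Fin 3) ℚ) (Fld n) (MvPolynomial.X (Sum.inl i))

/-- The list `(u X_1, v X_1^{−1}, u X_2, v X_2^{−1}, …, u X_i, v X_i^{−1})`
of `2i` quantities, where `i : Fin n` encodes the row index `i + 1`. -/
def rowArgs (n : ℕ) (i : Fin n) : List (Fld n) :=
  ((List.finRange n).take ((i : ℕ) + 1)).flatMap fun d => [uu n * XP d, vv n * (XP d)⁻¹]

/-- Two sequences on `ℤ` vanishing in negative degrees agree if they agree at `m` whenever they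
agree below `m`. -/
theorem eq_of_recursive_of_neg {α : Type*} {f g : ℤ → α} (h0 : ∀ m < 0, f m = g m)
    (hs : ∀ m, (∀ k < m, f k = g k) → f m = g m) (m : ℤ) : f m = g m := by
  have key : ∀ N : ℕ, ∀ m < (N : ℤ), f m = g m := by
    intro N
    induction N with
    | zero => exact fun m hm => h0 m (by simpa using hm)
    | succ N ih => exact fun m hm => hs m fun k hk => ih k (by push_cast at hm; omega)
  exact key (m.toNat + 1) m (by push_cast; omega)

section CompleteHomogeneous

variable {R : Type*} [CommRing R]

theorem hz_nil (m : ℤ) : hz m ([] : List R) = if m = 0 then 1 else 0 := by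
  rcases lt_trichotomy m 0 with h | h | h
  · simp [hz, h, h.ne]
  · simp [hz, h, hpow]
  · obtain ⟨k, rfl⟩ : ∃ k : ℕ, m = (k : ℤ) + 1 := ⟨(m - 1).toNat, by omega⟩
    have hk : ((k : ℤ) + 1).toNat = k + 1 := by omega
    have hk' : ¬ ((k : ℤ) + 1 < 0) := by omega
    simp [hz, hk, hk', hpow, h.ne']

theorem hz_of_neg {m : ℤ} (h : m < 0) (l : List R) : hz m l = 0 := by simp [hz, h]

theorem hz_cons (m : ℤ) (x : R) (xs : List R) :
    hz m (x :: xs) = hz m xs + x * hz (m - 1) (x :: xs) := by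
  rcases lt_trichotomy m 0 with h | h | h
  · simp [hz_of_neg h, hz_of_neg (show m - 1 < 0 by omega)]
  · subst h; simp [hz, hpow]
  · obtain ⟨k, rfl⟩ : ∃ k : ℕ, m = (k : ℤ) + 1 := ⟨(m - 1).toNat, by omega⟩
    have hk : ((k : ℤ) + 1).toNat = k + 1 := by omega
    have hk' : ¬ ((k : ℤ) + 1 < 0) := by omega
    have hk0 : ¬ ((k : ℤ) < 0) := by omega
    simp [hz, hk, hk', hk0, hpow]

theorem hz_swap (m : ℤ) (x y : R) (l : List R) :
    hz m (x :: y :: l) = hz m (y :: x :: l) := by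
  refine eq_of_recursive_of_neg (f := fun m => hz m (x :: y :: l))
    (g := fun m => hz m (y :: x :: l)) (fun m hm => ?_) (fun m ih => ?_) m
  · simp [hz_of_neg hm]
  · have h1 := ih (m - 1) (by omega)
    have h2 := ih (m - 1 - 1) (by omega)
    linear_combination hz_cons m x (y :: l) - hz_cons m y (x :: l) + hz_cons m y l
      - hz_cons m x l - y * hz_cons (m - 1) x (y :: l) + x * hz_cons (m - 1) y (x :: l)
      + (x + y) * h1 - x * y * h2

theorem hz_perm {l₁ l₂ : List R} (h : l₁.Perm l₂) : ∀ m : ℤ, hz m l₁ = hz m l₂ := by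
  induction h with
  | nil => exact fun _ => rfl
  | @cons x l₁ l₂ _ ih =>
    refine eq_of_recursive_of_neg (fun m hm => ?_) (fun m ihm => ?_)
    · simp [hz_of_neg hm]
    · rw [hz_cons, hz_cons m x l₂, ih, ihm (m - 1) (by omega)]
  | swap x y l => exact fun m => hz_swap m y x l
  | trans _ _ ih₁ ih₂ => exact fun m => (ih₁ m).trans (ih₂ m)

theorem hz_cons_cons (m : ℤ) (a b : R) (l : List R) :
    hz m l = hz m (a :: b :: l) - (a + b) * hz (m - 1) (a :: b :: l)
      + a * b * hz (m - 2) (a :: b :: l) := by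
  have h3 := hz_cons (m - 1) a (b :: l)
  rw [sub_sub] at h3
  norm_num at h3
  linear_combination - hz_cons m a (b :: l) - hz_cons m b l + b * h3

/-- The divided difference rule for pairs of variables with a common product. -/
theorem hz_pair_sub_hz_pair (m : ℤ) {a b a' b' : R} (h : a * b = a' * b') (l : List R) :
    hz m (a :: b :: l) = hz m (a' :: b' :: l)
      + (a + b - (a' + b')) * hz (m - 1) (a :: b :: a' :: b' :: l) := by
  have hp : (a :: b :: a' :: b' :: l).Perm (a' :: b' :: a :: b :: l) :=
    List.perm_append_comm_assoc [a, b] [a', b'] l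
  have h1 := hz_cons_cons m a b (a' :: b' :: l)
  have h2 := hz_cons_cons m a' b' (a :: b :: l)
  simp only [← hz_perm hp] at h2
  linear_combination h2 - h1 - hz (m - 2) (a :: b :: a' :: b' :: l) * h

theorem hz_singleton (k : ℕ) (a : R) : hz (k : ℤ) [a] = a ^ k := by
  induction k with
  | zero => simp [hz, hpow]
  | succ k ih =>
    rw [hz_cons, hz_nil, if_neg (by positivity)]
    simp [ih, pow_succ']

theorem pow_sub_pow_eq_mul_hz (k : ℕ) (a b : R) :
    a ^ k - b ^ k = (a - b) * hz ((k : ℤ) - 1) [a, b] := by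
  have h1 := hz_cons k a [b]
  have h2 := hz_cons k b [a]
  rw [hz_swap k b a [], hz_swap _ b a []] at h2
  rw [hz_singleton] at h1 h2
  linear_combination h1 - h2

/-- Newton interpolation for complete homogeneous symmetric polynomials in pairs of variables
with a common product. -/
theorem hz_pair_eq_newton_sum (a b : ℕ → R) (c : R) (hc : ∀ m, a m * b m = c) (x y : R)
    (hxy : x * y = c) (L : ℕ → List R) (hL0 : L 0 = [])
    (hL : ∀ r, (L (r + 1)).Perm (a r :: b r :: L r)) (k : ℤ) (r : ℕ) :
    hz k [x, y] =
      ∑ l ∈ Finset.range r, (∏ m ∈ Finset.range l, (x + y - (a m + b m))) * hz (k - l) (L (l + 1))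
      + (∏ m ∈ Finset.range r, (x + y - (a m + b m))) * hz (k - r) (x :: y :: L r) := by
  induction r with
  | zero => simp [hL0]
  | succ r ih =>
    have hp : (x :: y :: L (r + 1)).Perm (x :: y :: a r :: b r :: L r) :=
      ((hL r).cons y).cons x
    rw [ih, Finset.sum_range_succ, Finset.prod_range_succ,
      hz_pair_sub_hz_pair _ (hxy.trans (hc r).symm) (L r), hz_perm (hL r), hz_perm hp]
    push_cast
    rw [← sub_sub k]
    ring

theorem sq_add_mul_pow_eq_sum (w x : R) (j : ℕ) :
    (x ^ 2 + w * x) ^ j =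
      ∑ k ∈ Finset.Icc j (2 * j), (Nat.choose j (k - j) : R) * w ^ (2 * j - k) * x ^ k := by
  have h : Finset.Icc j (2 * j) = Finset.Ico j (2 * j + 1) := by ext; simp
  rw [h, Finset.sum_Ico_eq_sum_range, show x ^ 2 + w * x = x * (x + w) by ring, mul_pow, add_pow,
    Finset.mul_sum, show 2 * j + 1 - j = j + 1 by omega]
  refine Finset.sum_congr rfl fun m _ => ?_
  rw [show j + m - j = m by omega, show 2 * j - (j + m) = j - m by omega, pow_add]
  ring

theorem prod_fin_filter_lt_eq_prod_range {n : ℕ} (i : Fin n) (f : ℕ → R) :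
    ∏ m : Fin n, (if m < i then f m else 1) = ∏ m ∈ Finset.range i, f m := by
  have h := Fin.prod_univ_eq_prod_range (fun m => if m < (i : ℕ) then f m else 1) n
  simp only [Fin.lt_def]
  rw [h, ← Finset.prod_filter]
  refine Finset.prod_congr ?_ fun _ _ => rfl
  ext m
  have := i.isLt
  simp only [Finset.mem_filter, Finset.mem_range]
  omega

/-- The bialternant determinant factors through the Newton basis. -/
theorem det_pair_bialternant (n : ℕ) (a b : ℕ → R) (c w : R) (hc : ∀ m, a m * b m = c)
    (L : ℕ → List R) (hL0 : L 0 = []) (hL : ∀ r, (L (r + 1)).Perm (a r :: b r :: L r)) :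
    (Matrix.of fun i j : Fin n =>
        ((a i) ^ 2 + w * a i) ^ ((j : ℕ) + 1) - ((b i) ^ 2 + w * b i) ^ ((j : ℕ) + 1)).det =
      (∏ i : Fin n, (a i - b i)) *
        (∏ p ∈ Finset.univ.filter (fun p : Fin n × Fin n => p.1 < p.2),
          (a p.2 + b p.2 - (a p.1 + b p.1))) *
        (Matrix.of fun i j : Fin n =>
          ∑ k ∈ Finset.Icc ((j : ℕ) + 1) (2 * ((j : ℕ) + 1)),
            (Nat.choose ((j : ℕ) + 1) (k - ((j : ℕ) + 1)) : R) *
              w ^ (2 * ((j : ℕ) + 1) - k) *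
              hz ((k : ℤ) - ((i : ℕ) + 1)) (L (i + 1))).det := by
  set N : Matrix (Fin n) (Fin n) R := Matrix.of fun i l =>
    ∏ m ∈ Finset.range l, (a i + b i - (a m + b m)) with hN
  set J : Matrix (Fin n) (Fin n) R := Matrix.of fun i j =>
    ∑ k ∈ Finset.Icc ((j : ℕ) + 1) (2 * ((j : ℕ) + 1)),
      (Nat.choose ((j : ℕ) + 1) (k - ((j : ℕ) + 1)) : R) * w ^ (2 * ((j : ℕ) + 1) - k) *
        hz ((k : ℤ) - ((i : ℕ) + 1)) (L (i + 1)) with hJ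
  have hNewton : ∀ (i : Fin n) (k : ℤ), hz (k - 1) [a i, b i] =
      ∑ l : Fin n, N i l * hz (k - ((l : ℕ) + 1)) (L (l + 1)) := by
    intro i k
    rw [hz_pair_eq_newton_sum a b c hc _ _ (hc i) L hL0 hL (k - 1) n,
      Finset.prod_eq_zero (Finset.mem_range.2 i.isLt) (sub_self _), zero_mul, add_zero,
      ← Fin.sum_univ_eq_sum_range (fun l => (∏ m ∈ Finset.range l,
        (a i + b i - (a m + b m))) * hz (k - 1 - l) (L (l + 1))) n]
    refine Finset.sum_congr rfl fun l _ => ?_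
    rw [hN, Matrix.of_apply, show k - 1 - ((l : ℕ) : ℤ) = k - (((l : ℕ) : ℤ) + 1) by ring]
  have hfactor : (Matrix.of fun i j : Fin n =>
      ((a i) ^ 2 + w * a i) ^ ((j : ℕ) + 1) - ((b i) ^ 2 + w * b i) ^ ((j : ℕ) + 1)) =
      Matrix.diagonal (fun i : Fin n => a i - b i) * (N * J) := by
    ext i j
    rw [Matrix.diagonal_mul, Matrix.mul_apply, Matrix.of_apply, sq_add_mul_pow_eq_sum,
      sq_add_mul_pow_eq_sum, ← Finset.sum_sub_distrib]
    simp only [hJ, Matrix.of_apply, Finset.mul_sum]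
    rw [Finset.sum_comm]
    refine Finset.sum_congr rfl fun k _ => ?_
    rw [← mul_sub, pow_sub_pow_eq_mul_hz, hNewton, Finset.mul_sum, Finset.mul_sum]
    exact Finset.sum_congr rfl fun l _ => by ring
  have htri : N.BlockTriangular OrderDual.toDual := by
    intro i l h
    have hil : (i : ℕ) < l := h
    exact Finset.prod_eq_zero (Finset.mem_range.2 hil) (sub_self _)
  have hdet : N.det = ∏ p ∈ Finset.univ.filter (fun p : Fin n × Fin n => p.1 < p.2),
      (a p.2 + b p.2 - (a p.1 + b p.1)) := by
    rw [Matrix.det_of_isLowerTriangular N htri, Finset.prod_filter, Fintype.prod_prod_type_right]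
    refine Finset.prod_congr rfl fun i _ => ?_
    exact (prod_fin_filter_lt_eq_prod_range i fun m => a i + b i - (a m + b m)).symm
  rw [hfactor, Matrix.det_mul, Matrix.det_mul, Matrix.det_diagonal, hdet, mul_assoc]

end CompleteHomogeneous

theorem XP_ne_zero {n : ℕ} (i : Fin n) : XP i ≠ 0 := by
  rw [XP, Ne, IsFractionRing.to_map_eq_zero_iff]
  exact MvPolynomial.X_ne_zero _

theorem rowArgs_eq_flatMap_range {n : ℕ} (i : Fin n) (a b : ℕ → Fld n)
    (ha : ∀ d : Fin n, a d = uu n * XP d) (hb : ∀ d : Fin n, b d = vv n * (XP d)⁻¹) :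
    rowArgs n i = (List.range ((i : ℕ) + 1)).flatMap fun d => [a d, b d] := by
  have h : List.range ((i : ℕ) + 1) = ((List.finRange n).take ((i : ℕ) + 1)).map Fin.val := by
    rw [List.map_take, List.map_coe_finRange_eq_range, List.take_range,
      min_eq_left (show (i : ℕ) + 1 ≤ n from i.isLt)]
  rw [h, List.flatMap_map, rowArgs]
  simp only [ha, hb]

/-- **Jacobi–Trudi type formula (first version).** For `n ≥ 1`, in `ℚ(u,v,w,X_1,…,X_n)`:
`det_{1≤i,j≤n}((u²X_i² + uwX_i)^j − (v²X_i^{−2} + vwX_i^{−1})^j)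
 = ∏_{i=1}^n (uX_i − vX_i^{−1}) · ∏_{1≤i<j≤n} (X_j − X_i)(u − vX_i^{−1}X_j^{−1})
   · det_{1≤i,j≤n}(Σ_{k=j}^{2j} binom(j, k−j) w^{2j−k} h_{k−i}(uX_1, vX_1^{−1}, …, uX_i, vX_i^{−1}))`. -/
theorem det_bialternant_eq_jacobiTrudi (n : ℕ) (hn : 1 ≤ n) :
    (Matrix.of fun i j : Fin n =>
        ((uu n) ^ 2 * (XP i) ^ 2 + uu n * wP n * XP i) ^ ((j : ℕ) + 1) -
          ((vv n) ^ 2 * ((XP i)⁻¹) ^ 2 + vv n * wP n * (XP i)⁻¹) ^ ((j : ℕ) + 1)).det =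
      (∏ i : Fin n, (uu n * XP i - vv n * (XP i)⁻¹)) *
        (∏ p ∈ Finset.univ.filter (fun p : Fin n × Fin n => p.1 < p.2),
          ((XP p.2 - XP p.1) * (uu n - vv n * (XP p.1)⁻¹ * (XP p.2)⁻¹))) *
        (Matrix.of fun i j : Fin n =>
          ∑ k ∈ Finset.Icc ((j : ℕ) + 1) (2 * ((j : ℕ) + 1)),
            (Nat.choose ((j : ℕ) + 1) (k - ((j : ℕ) + 1)) : Fld n) *
              wP n ^ (2 * ((j : ℕ) + 1) - k) *
              hz ((k : ℤ) - ((i : ℕ) + 1)) (rowArgs n i)).det := by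
  set a : ℕ → Fld n := fun m => if h : m < n then uu n * XP ⟨m, h⟩ else uu n with ha
  set b : ℕ → Fld n := fun m => if h : m < n then vv n * (XP ⟨m, h⟩)⁻¹ else vv n with hb
  have ha' : ∀ d : Fin n, a d = uu n * XP d := fun d => by simp [ha]
  have hb' : ∀ d : Fin n, b d = vv n * (XP d)⁻¹ := fun d => by simp [hb]
  have hc : ∀ m, a m * b m = uu n * vv n := by
    intro m
    by_cases h : m < n
    · have := XP_ne_zero (⟨m, h⟩ : Fin n)
      simp only [ha, hb, h, dif_pos]
      field_simp
    · simp [ha, hb, h]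
  have key := det_pair_bialternant n a b (uu n * vv n) (wP n) hc
    (fun r => (List.range r).flatMap fun d => [a d, b d]) rfl (fun r => by
      simp only [List.range_succ, List.flatMap_append, List.flatMap_singleton]
      exact List.perm_append_comm)
  simp only [← rowArgs_eq_flatMap_range _ a b ha' hb', ha', hb'] at key
  convert key using 3
  · ext i j
    ring_nf
  · refine Finset.prod_congr rfl fun p _ => ?_
    have h1 := XP_ne_zero p.1
    have h2 := XP_ne_zero p.2
    field_simp
    ring

end
end

section
/- Let l ≥ 1 be an integer. In the Laurent polynomial ring ℤ[u, v][X, X^{−1}], the following identity holds: u^l X^l − v^l X^{−l} = (u X − v X^{−1}) · Σ_{r=0}^{⌊(l−1)/2⌋} (−u v)^r · binom(l − r − 1, r) · (u X + v X^{−1})^{l − 2r − 1}. -/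
open LaurentPolynomial

noncomputable section

/-- The coefficient ring `ℤ[u, v]`. -/
abbrev CoeffR : Type := MvPolynomial (Fin 2) ℤ

/-- The Laurent polynomial ring `ℤ[u, v][X, X⁻¹]`. -/
abbrev LP : Type := LaurentPolynomial CoeffR

/-- The indeterminate `u`. -/
def uL : LP := LaurentPolynomial.C (MvPolynomial.X 0)

/-- The indeterminate `v`. -/
def vL : LP := LaurentPolynomial.C (MvPolynomial.X 1)

/-- The sum `∑ (-xy)^j * binom(i, j) * (x + y)^(i - j)` over `i + j = n`, multiplied by `x - y`,
is `x^(n+1) - y^(n+1)`. -/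
theorem sub_mul_sum_antidiagonal_choose {R : Type*} [CommRing R] (x y : R) (n : ℕ) :
    (x - y) * ∑ q ∈ Finset.HasAntidiagonal.antidiagonal n,
      (-(x * y)) ^ q.2 * (q.1.choose q.2 : R) * (x + y) ^ (q.1 - q.2) =
        x ^ (n + 1) - y ^ (n + 1) := by
  induction n using Nat.twoStepInduction with
  | zero => simp
  | one => simp [Finset.Nat.antidiagonal_succ]; ring
  | more n ih₀ ih₁ =>
    have key : ∑ q ∈ Finset.HasAntidiagonal.antidiagonal (n + 2),
          (-(x * y)) ^ q.2 * (q.1.choose q.2 : R) * (x + y) ^ (q.1 - q.2) =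
        (x + y) * ∑ q ∈ Finset.HasAntidiagonal.antidiagonal (n + 1),
          (-(x * y)) ^ q.2 * (q.1.choose q.2 : R) * (x + y) ^ (q.1 - q.2) +
        -(x * y) * ∑ q ∈ Finset.HasAntidiagonal.antidiagonal n,
          (-(x * y)) ^ q.2 * (q.1.choose q.2 : R) * (x + y) ^ (q.1 - q.2) := by
      have hterm (i j : ℕ) :
          (-(x * y)) ^ (j + 1) * ((i + 1).choose (j + 1) : R) * (x + y) ^ (i + 1 - (j + 1)) =
            (x + y) * ((-(x * y)) ^ (j + 1) * (i.choose (j + 1) : R) * (x + y) ^ (i - (j + 1))) +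
            -(x * y) * ((-(x * y)) ^ j * (i.choose j : R) * (x + y) ^ (i - j)) := by
        rw [Nat.choose_succ_succ, Nat.add_sub_add_right]
        rcases lt_or_ge i (j + 1) with h | h
        · simp only [Nat.choose_eq_zero_of_lt h]
          push_cast
          ring
        · obtain ⟨k, rfl⟩ := Nat.exists_eq_add_of_le h
          rw [Nat.add_sub_cancel_left, show j + 1 + k - j = k + 1 by lia]
          push_cast
          ring
      rw [Finset.Nat.sum_antidiagonal_succ', Finset.Nat.sum_antidiagonal_succ,
        Finset.Nat.sum_antidiagonal_succ' (n := n)]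
      simp only [hterm, Finset.sum_add_distrib, ← Finset.mul_sum]
      simp
      ring
    rw [key]
    linear_combination (x + y) * ih₁ - x * y * ih₀

/-- Only the indices `r ≤ n / 2` contribute to the sum over the antidiagonal. -/
theorem sum_antidiagonal_choose_eq_sum_range {R : Type*} [CommRing R] (p s : R) (n : ℕ) :
    ∑ q ∈ Finset.HasAntidiagonal.antidiagonal n,
        p ^ q.2 * (q.1.choose q.2 : R) * s ^ (q.1 - q.2) =
      ∑ r ∈ Finset.range (n / 2 + 1), p ^ r * ((n - r).choose r : R) * s ^ (n - 2 * r) := by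
  rw [← Finset.Nat.sum_antidiagonal_swap, Finset.Nat.sum_antidiagonal_eq_sum_range_succ_mk]
  symm
  refine Finset.sum_subset_zero_on_sdiff (Finset.range_mono (by lia)) (fun r hr => ?_)
    (fun r _ => ?_)
  · simp only [Finset.mem_sdiff, Finset.mem_range] at hr
    simp [Nat.choose_eq_zero_of_lt (show n - r < r by lia)]
  · simp [Nat.sub_sub, two_mul]

/-- For `l ≥ 1`, the quotient of `x^l - y^l` by `x - y`, expanded in `xy` and `x + y`. -/
theorem pow_sub_pow_eq_sub_mul_sum_choose {R : Type*} [CommRing R] (x y : R) {l : ℕ}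
    (hl : 1 ≤ l) :
    x ^ l - y ^ l = (x - y) * ∑ r ∈ Finset.range ((l - 1) / 2 + 1),
      (-(x * y)) ^ r * (Nat.choose (l - r - 1) r : R) * (x + y) ^ (l - 2 * r - 1) := by
  obtain ⟨n, rfl⟩ := Nat.exists_eq_add_of_le' hl
  rw [← sub_mul_sum_antidiagonal_choose, sum_antidiagonal_choose_eq_sum_range]
  simp only [Nat.sub_right_comm (n + 1) _ 1, Nat.add_sub_cancel]

/-- **Lemma.** For `l ≥ 1`, in `ℤ[u, v][X, X⁻¹]`:
`u^l X^l − v^l X^{−l}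
  = (uX − vX^{−1}) · Σ_{r=0}^{⌊(l−1)/2⌋} (−uv)^r · binom(l−r−1, r) · (uX + vX^{−1})^{l−2r−1}`. -/
theorem pow_sub_pow_eq_sum_uXvXinv (l : ℕ) (hl : 1 ≤ l) :
    uL ^ l * T (l : ℤ) - vL ^ l * T (-(l : ℤ)) =
      (uL * T 1 - vL * T (-1)) *
        ∑ r ∈ Finset.range ((l - 1) / 2 + 1),
          (-(uL * vL)) ^ r * (Nat.choose (l - r - 1) r : LP) *
            (uL * T 1 + vL * T (-1)) ^ (l - 2 * r - 1) := by
  have hprod : uL * T 1 * (vL * T (-1)) = uL * vL := by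
    rw [mul_mul_mul_comm, ← T_add, add_neg_cancel, T_zero, mul_one]
  have h := pow_sub_pow_eq_sub_mul_sum_choose (uL * T 1) (vL * T (-1)) hl
  rw [hprod, mul_pow, mul_pow, T_pow, T_pow, mul_one, mul_neg_one] at h
  exact h

end
end

section
/- Let l ≥ 1 and k ≥ 0 be integers. Then Σ_{r=0}^{⌊(l−1)/2⌋} (−1)^r · binom(l − r − 1, r) · binom(l − 2r − 1, k − r) = 1 if k ≤ l − 1, and = 0 if k ≥ l. -/
/-- Integer binomial coefficient: `ibinom a b = binom(a, b)` for `0 ≤ b ≤ a`,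
and `0` when `b < 0` or `b > a`. -/
def ibinom (a b : ℤ) : ℤ := if 0 ≤ b ∧ b ≤ a then (a.toNat.choose b.toNat : ℤ) else 0

open Finset Polynomial

theorem sum_antidiagonal_choose_mul_pow_add_two {R : Type*} [CommSemiring R] (a b : R) (n : ℕ) :
    ∑ p ∈ antidiagonal (n + 2), (p.1.choose p.2 : R) * a ^ (p.1 - p.2) * b ^ p.2 =
      a * ∑ p ∈ antidiagonal (n + 1), (p.1.choose p.2 : R) * a ^ (p.1 - p.2) * b ^ p.2 +
        b * ∑ p ∈ antidiagonal n, (p.1.choose p.2 : R) * a ^ (p.1 - p.2) * b ^ p.2 := by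
  have hterm (i j : ℕ) :
      ((i + 1).choose (j + 1) : R) * a ^ (i + 1 - (j + 1)) * b ^ (j + 1) =
        a * ((i.choose (j + 1) : R) * a ^ (i - (j + 1)) * b ^ (j + 1)) +
          b * ((i.choose j : R) * a ^ (i - j) * b ^ j) := by
    rw [Nat.choose_succ_succ, Nat.add_sub_add_right]
    rcases lt_or_ge i (j + 1) with h | h
    · rw [Nat.choose_eq_zero_of_lt h]
      push_cast
      ring
    · obtain ⟨m, rfl⟩ := Nat.exists_eq_add_of_le h
      rw [Nat.add_sub_cancel_left, show j + 1 + m - j = m + 1 by omega]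
      push_cast
      ring
  rw [Finset.Nat.antidiagonal_succ_succ', Finset.Nat.sum_antidiagonal_succ' (n := n)]
  simp only [sum_cons, sum_map, Function.Embedding.prodMap, Function.Embedding.coeFn_mk,
    Prod.map, Nat.succ_eq_add_one, hterm, sum_add_distrib, mul_sum, mul_add]
  simp
  ring

theorem sum_antidiagonal_choose_mul_one_add_pow {R : Type*} [CommRing R] (x : R) (n : ℕ) :
    ∑ p ∈ antidiagonal n, (p.1.choose p.2 : R) * (1 + x) ^ (p.1 - p.2) * (-x) ^ p.2 =
      ∑ i ∈ range (n + 1), x ^ i := by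
  induction n using Nat.twoStepInduction with
  | zero => simp
  | one => simp [Finset.Nat.antidiagonal_succ, sum_range_succ]
  | more n ih₀ ih₁ =>
    rw [sum_antidiagonal_choose_mul_pow_add_two, ih₀, ih₁, sum_range_succ _ (n + 2),
      sum_range_succ _ (n + 1)]
    ring

theorem ibinom_natCast (a b : ℕ) : ibinom a b = a.choose b := by
  unfold ibinom
  split_ifs with h
  · simp
  · rw [Nat.choose_eq_zero_of_lt (by omega), Nat.cast_zero]

theorem coeff_one_add_X_pow_mul_neg_X_pow (m r k : ℕ) :
    ((1 + X : ℤ[X]) ^ m * (-X) ^ r).coeff k = (-1) ^ r * ibinom m ((k : ℤ) - r) := by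
  have hC : (-X : ℤ[X]) ^ r = C ((-1) ^ r) * X ^ r := by
    rw [neg_pow]
    simp
  rw [hC, mul_left_comm, coeff_C_mul, coeff_mul_X_pow']
  split_ifs with h
  · rw [coeff_one_add_X_pow, ← Nat.cast_sub h, ibinom_natCast]
  · rw [ibinom, if_neg (by omega)]

/-- **Lemma.** For integers `l ≥ 1` and `k ≥ 0`:
`Σ_{r=0}^{⌊(l−1)/2⌋} (−1)^r · binom(l−r−1, r) · binom(l−2r−1, k−r)`
equals `1` if `k ≤ l − 1` and `0` if `k ≥ l`. -/
theorem alternating_binom_sum (l k : ℕ) (hl : 1 ≤ l) :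
    (∑ r ∈ Finset.range ((l - 1) / 2 + 1),
        (-1 : ℤ) ^ r * ibinom ((l : ℤ) - r - 1) r * ibinom ((l : ℤ) - 2 * r - 1) ((k : ℤ) - r)) =
      if (k : ℤ) ≤ (l : ℤ) - 1 then 1 else 0 := by
  obtain ⟨n, rfl⟩ := Nat.exists_eq_add_of_le' hl
  have key := congrArg (coeff · k) (sum_antidiagonal_choose_mul_one_add_pow (X : ℤ[X]) n)
  rw [← Finset.Nat.sum_antidiagonal_swap, Finset.Nat.sum_antidiagonal_eq_sum_range_succ_mk] at key
  simp only [Prod.fst_swap, Prod.snd_swap, mul_assoc, finsetSum_coeff, coeff_natCast_mul,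
    coeff_one_add_X_pow_mul_neg_X_pow, coeff_X_pow, sum_ite_eq, mem_range] at key
  have hsub : range ((n + 1 - 1) / 2 + 1) ⊆ range (n + 1) :=
    range_subset_range.mpr (by omega)
  rw [sum_subset hsub]
  · convert key using 1
    · refine sum_congr rfl fun r hr => ?_
      rw [mem_range] at hr
      rw [show ((n + 1 : ℕ) : ℤ) - r - 1 = (n - r : ℕ) by omega, ibinom_natCast]
      rcases lt_or_ge (n - r) r with h | h
      · simp [Nat.choose_eq_zero_of_lt h]
      · rw [show ((n + 1 : ℕ) : ℤ) - 2 * r - 1 = (n - r - r : ℕ) by omega]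
        ring
    · exact if_congr (by omega) rfl rfl
  · intro r _ hr
    rw [mem_range] at hr
    rw [ibinom, if_neg (by omega), mul_zero, zero_mul]
end

section
/- Let p and j be positive integers. Then Σ_{q} 2^{q−j} · (−1)^{(p−q)/2} · binom((p+q)/2 − 1, (p−q)/2) · binom(q − 1, j − 1) = binom(p + j − 1, p − j), where the sum ranges over all integers q with j ≤ q ≤ p and q ≡ p (mod 2). -/
namespace Polynomial.Chebyshev

open Finset

theorem S_eq_sum_antidiagonal (R : Type*) [CommRing R] (n : ℕ) :
    S R n = ∑ k ∈ antidiagonal n, (-1) ^ k.2 * (k.1.choose k.2 : R[X]) * X ^ (k.1 - k.2) := by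
  induction n using Nat.twoStepInduction with
  | zero => simp
  | one => simp [Nat.antidiagonal_succ]
  | more n ih₀ ih₁ =>
    have pascal (i j : ℕ) :
        ((-1) ^ (j + 1) * ((i + 1).choose (j + 1) : R[X]) * X ^ (i + 1 - (j + 1)) : R[X]) =
          X * ((-1) ^ (j + 1) * (i.choose (j + 1) : R[X]) * X ^ (i - (j + 1))) -
            (-1) ^ j * (i.choose j : R[X]) * X ^ (i - j) := by
      rcases lt_or_ge j i with h | h
      · obtain ⟨d, rfl⟩ := Nat.exists_eq_add_of_lt h
        rw [Nat.choose_succ_succ, show j + d + 1 + 1 - (j + 1) = d + 1 by lia,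
          show j + d + 1 - (j + 1) = d by lia, show j + d + 1 - j = d + 1 by lia]
        push_cast
        ring
      · rw [Nat.choose_succ_succ, Nat.choose_eq_zero_of_lt (Nat.lt_succ_of_le h),
          Nat.add_sub_add_right]
        push_cast
        ring
    push_cast at ih₁ ⊢
    rw [S_add_two, ih₀, ih₁, Finset.Nat.antidiagonal_succ_succ', Finset.Nat.antidiagonal_succ']
    simp only [sum_cons, sum_map, Function.Embedding.prodMap, Function.Embedding.coeFn_mk,
      Prod.map, Function.Embedding.refl_apply, Nat.succ_eq_add_one, pascal, sum_sub_distrib,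
      mul_add, ← mul_sum]
    simp
    ring

theorem coeff_taylor_two_S (R : Type*) [CommRing R] (n m : ℕ) :
    (taylor 2 (S R n)).coeff m = ((n + m + 1).choose (2 * m + 1) : R) := by
  induction n using Nat.twoStepInduction generalizing m with
  | zero =>
    rcases m with _ | m
    · simp
    · rw [Nat.choose_eq_zero_of_lt (by lia)]
      simp [coeff_one]
  | one =>
    rcases m with _ | _ | m
    · simp [taylor_X]
    · simp [taylor_X]
    · rw [Nat.choose_eq_zero_of_lt (by lia)]
      simp [taylor_X, coeff_X]
  | more n ih₀ ih₁ =>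
    push_cast at ih₁ ⊢
    rw [S_add_two, map_sub, taylor_mul, taylor_X, add_mul, coeff_sub, coeff_add, coeff_C_mul,
      ih₀, ih₁]
    rcases m with _ | m
    · simp
      ring
    · rw [coeff_X_mul, ih₁]
      have h : (n + 2 + (m + 1) + 1).choose (2 * (m + 1) + 1) +
          (n + (m + 1) + 1).choose (2 * (m + 1) + 1) =
            2 * (n + 1 + (m + 1) + 1).choose (2 * (m + 1) + 1) +
              (n + 1 + m + 1).choose (2 * m + 1) := by
        rw [show n + 2 + (m + 1) + 1 = n + m + 2 + 1 + 1 by lia,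
          show n + (m + 1) + 1 = n + m + 2 by lia,
          show n + 1 + (m + 1) + 1 = n + m + 2 + 1 by lia,
          show n + 1 + m + 1 = n + m + 2 by lia, show 2 * (m + 1) + 1 = 2 * m + 1 + 1 + 1 by lia]
        simp only [Nat.choose_succ_succ (n + m + 2 + 1), Nat.choose_succ_succ (n + m + 2)]
        ring
      have h' := congrArg (Nat.cast : ℕ → R) h
      push_cast at h'
      linear_combination -h'

theorem sum_antidiagonal_eq_choose (R : Type*) [CommRing R] (n m : ℕ) :
    ∑ k ∈ antidiagonal n, (-1) ^ k.2 * (k.1.choose k.2 : R) *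
      (2 ^ (k.1 - k.2 - m) * ((k.1 - k.2).choose m : R)) =
        ((n + m + 1).choose (2 * m + 1) : R) := by
  rw [← coeff_taylor_two_S, S_eq_sum_antidiagonal, map_sum, finsetSum_coeff]
  refine sum_congr rfl fun k _ ↦ ?_
  rw [← coeff_X_add_C_pow, ← coeff_C_mul, taylor_mul, taylor_pow, taylor_X]
  simp [taylor_apply]

end Polynomial.Chebyshev

/-- **Identity (5.1).** For positive integers `p`, `j`:
`Σ_q 2^{q−j} (−1)^{(p−q)/2} binom((p+q)/2 − 1, (p−q)/2) binom(q−1, j−1) = binom(p+j−1, p−j)`,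
where `q` runs over integers with `j ≤ q ≤ p` and `q ≡ p (mod 2)`. -/
theorem sum_two_pow_binom_eq_binom (p j : ℕ) (hp : 1 ≤ p) (hj : 1 ≤ j) :
    (∑ q ∈ (Finset.Icc j p).filter (fun q => q % 2 = p % 2),
        (2 : ℤ) ^ (q - j) * (-1 : ℤ) ^ ((p - q) / 2) *
          (Nat.choose ((p + q) / 2 - 1) ((p - q) / 2) : ℤ) *
          (Nat.choose (q - 1) (j - 1) : ℤ)) =
      ibinom ((p : ℤ) + j - 1) ((p : ℤ) - j) := by
  obtain ⟨n, rfl⟩ := Nat.exists_eq_add_of_le' hp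
  obtain ⟨m, rfl⟩ := Nat.exists_eq_add_of_le' hj
  have rhs : ibinom (((n + 1 : ℕ) : ℤ) + (m + 1 : ℕ) - 1) (((n + 1 : ℕ) : ℤ) - (m + 1 : ℕ)) =
      ((n + m + 1).choose (2 * m + 1) : ℤ) := by
    unfold ibinom
    split_ifs with h
    · rw [show (((n + 1 : ℕ) : ℤ) + (m + 1 : ℕ) - 1).toNat = n + m + 1 by lia,
        show (((n + 1 : ℕ) : ℤ) - (m + 1 : ℕ)).toNat = n - m by lia,
        Nat.choose_symm_of_eq_add (show n + m + 1 = n - m + (2 * m + 1) by lia)]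
    · rw [Nat.choose_eq_zero_of_lt (by lia), Nat.cast_zero]
  rw [rhs, ← Polynomial.Chebyshev.sum_antidiagonal_eq_choose]
  refine Finset.sum_of_injOn (fun q ↦ ((n + 1 + q) / 2 - 1, (n + 1 - q) / 2)) ?_ ?_ ?_ ?_
  · intro q hq r hr h
    simp only [Finset.coe_filter, Finset.mem_Icc, Set.mem_ofPred_eq, Prod.mk.injEq] at hq hr h
    lia
  · intro q hq
    simp only [Finset.coe_filter, Finset.mem_Icc, Set.mem_ofPred_eq, Finset.mem_coe,
      Finset.HasAntidiagonal.mem_antidiagonal] at hq ⊢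
    lia
  · rintro ⟨a, b⟩ hab himage
    rw [Finset.HasAntidiagonal.mem_antidiagonal] at hab
    dsimp only at hab ⊢
    rcases lt_or_ge a b with h | h
    · simp [Nat.choose_eq_zero_of_lt h]
    · rcases lt_or_ge (a - b) m with h' | h'
      · simp [Nat.choose_eq_zero_of_lt h']
      · refine absurd ⟨a - b + 1, ?_, ?_⟩ himage
        · simp only [Finset.coe_filter, Finset.mem_Icc, Set.mem_ofPred_eq]
          lia
        · simp only [Prod.mk.injEq]
          lia
  · intro q hq
    simp only [Finset.mem_filter, Finset.mem_Icc] at hq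
    dsimp only
    rw [show (n + 1 + q) / 2 - 1 - (n + 1 - q) / 2 = q - 1 by lia,
      show q - 1 - m = q - (m + 1) by lia, Nat.add_sub_cancel]
    ring
end

section
/- Let i and j be positive integers. Then Σ_{p=1}^{2i} (−1)^{2i−p} · binom(i, 2i − p) · binom(p + j − 1, p − j) = binom(i + j − 1, 2j − i − 1). -/
theorem fwdDiff_iter_choose_eq_zero_of_lt {m n : ℕ} (hmn : m < n) :
    (fwdDiff 1)^[n] (fun x ↦ x.choose m : ℕ → ℤ) = 0 := by
  obtain ⟨k, rfl⟩ := Nat.exists_eq_add_of_lt hmn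
  funext y
  rw [show m + k + 1 = k + 1 + m by ring, Function.iterate_add_apply]
  have h := fwdDiff_iter_choose 0 m
  rw [add_zero] at h
  simp_rw [h, Nat.choose_zero_right, Function.iterate_succ_apply, fwdDiff_const,
    fwdDiff_iter_eq_sum_shift]
  simp

theorem ibinom_natCast_s5 (n m : ℕ) : ibinom n m = n.choose m := by
  unfold ibinom
  split_ifs with h
  · simp
  · rw [Nat.choose_eq_zero_of_lt (by omega), Nat.cast_zero]

theorem ibinom_of_neg {a b : ℤ} (hb : b < 0) : ibinom a b = 0 :=
  if_neg fun h ↦ hb.not_ge h.1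

theorem ibinom_sub_natCast (n m : ℕ) : ibinom n (n - m) = n.choose m := by
  rcases le_or_gt m n with h | h
  · rw [← Nat.cast_sub h, ibinom_natCast_s5, Nat.choose_symm h]
  · rw [ibinom_of_neg (by omega), Nat.choose_eq_zero_of_lt h, Nat.cast_zero]

/-- **Identity (5.2).** For positive integers `i`, `j`:
`Σ_{p=1}^{2i} (−1)^{2i−p} binom(i, 2i−p) binom(p+j−1, p−j) = binom(i+j−1, 2j−i−1)`. -/
theorem sum_binom_binom_eq_binom (i j : ℕ) (hi : 1 ≤ i) (hj : 1 ≤ j) :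
    (∑ p ∈ Finset.Icc 1 (2 * i),
        (-1 : ℤ) ^ (2 * i - p) * (Nat.choose i (2 * i - p) : ℤ) *
          ibinom ((p : ℤ) + j - 1) ((p : ℤ) - j)) =
      ibinom ((i : ℤ) + j - 1) (2 * (j : ℤ) - i - 1) := by
  have sum_eq : (∑ p ∈ Finset.Icc 1 (2 * i), (-1 : ℤ) ^ (2 * i - p) *
      (Nat.choose i (2 * i - p) : ℤ) * ibinom ((p : ℤ) + j - 1) ((p : ℤ) - j)) =
      (fwdDiff 1)^[i] (fun x ↦ x.choose (2 * j - 1) : ℕ → ℤ) (i + j - 1) := by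
    rw [fwdDiff_iter_eq_sum_shift]
    symm
    refine Finset.sum_of_injOn (fun k ↦ i + k) (by simp) ?_ ?_ ?_
    · intro k hk
      simp only [Finset.coe_range, Set.mem_Iio, Finset.coe_Icc, Set.mem_Icc] at hk ⊢
      omega
    · intro p hp hpi
      have hlt : p < i := by
        by_contra! hle
        simp only [Finset.mem_Icc] at hp
        exact hpi ⟨p - i, by simp only [Finset.coe_range, Set.mem_Iio]; omega, by grind⟩
      rw [Nat.choose_eq_zero_of_lt (by omega : i < 2 * i - p)]
      simp
    · intro k hk
      have hki : k ≤ i := Nat.lt_succ_iff.mp (Finset.mem_range.mp hk)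
      have hb := ibinom_sub_natCast (i + j - 1 + k) (2 * j - 1)
      rw [show (((i + j - 1 + k : ℕ) : ℤ)) = ((i + k : ℕ) : ℤ) + j - 1 by omega,
        show ((i + k : ℕ) : ℤ) + j - 1 - ((2 * j - 1 : ℕ) : ℤ) = ((i + k : ℕ) : ℤ) - j by omega]
        at hb
      rw [hb, show 2 * i - (i + k) = i - k by omega, Nat.choose_symm hki]
      simp
  rw [sum_eq]
  rcases le_or_gt i (2 * j - 1) with h | h
  · obtain ⟨m, hm⟩ := Nat.exists_eq_add_of_le h
    rw [hm, fwdDiff_iter_choose]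
    beta_reduce
    rw [← ibinom_natCast_s5]
    congr 1 <;> omega
  · rw [fwdDiff_iter_choose_eq_zero_of_lt h, ibinom_of_neg (by omega), Pi.zero_apply]
end

section
/- Let n ≥ 1, let R be a commutative ring and let A_1, …, A_n, B_1, …, B_n, t ∈ R. Then det_{1 ≤ i, j ≤ n} (A_i^j − B_i^j) = det_{1 ≤ i, j ≤ n} ( (A_i + t)^j − (B_i + t)^j ). -/
/-- The binomial expansion of `(x + t) ^ (j + 1)` with its constant term split off, the sum being
padded by zeros to a fixed length `n`. -/
theorem add_pow_succ_eq_sum_fin_add {R : Type*} [CommRing R] {n : ℕ} (j : Fin n) (x t : R) :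
    (x + t) ^ ((j : ℕ) + 1) =
      ∑ k : Fin n, x ^ ((k : ℕ) + 1) *
        (t ^ ((j : ℕ) - k) * (((j : ℕ) + 1).choose ((k : ℕ) + 1) : R)) + t ^ ((j : ℕ) + 1) := by
  rw [add_pow, Finset.sum_range_succ', Fin.sum_univ_eq_sum_range (fun k => x ^ (k + 1) *
    (t ^ ((j : ℕ) - k) * (((j : ℕ) + 1).choose (k + 1) : R))) n]
  congr 1
  · refine Finset.sum_subset_zero_on_sdiff (Finset.range_subset_range.2 j.isLt) ?_ ?_
    · intro k hk
      have hjk : (j : ℕ) + 1 < k + 1 := by simp at hk; omega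
      simp [Nat.choose_eq_zero_of_lt hjk]
    · intro k _
      rw [Nat.add_sub_add_right, mul_assoc]
  · simp

/-- For `n ≥ 1`, a commutative ring `R`, `A_1, …, A_n, B_1, …, B_n, t ∈ R`:
`det_{1 ≤ i,j ≤ n} (A_i^j − B_i^j) = det_{1 ≤ i,j ≤ n} ((A_i + t)^j − (B_i + t)^j)`. -/
theorem det_pow_sub_shift_invariant {R : Type*} [CommRing R] (n : ℕ) (hn : 1 ≤ n)
    (A B : Fin n → R) (t : R) :
    (Matrix.of fun i j : Fin n => A i ^ ((j : ℕ) + 1) - B i ^ ((j : ℕ) + 1)).det =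
      (Matrix.of fun i j : Fin n =>
        (A i + t) ^ ((j : ℕ) + 1) - (B i + t) ^ ((j : ℕ) + 1)).det := by
  let U : Matrix (Fin n) (Fin n) R := Matrix.of fun k j =>
    t ^ ((j : ℕ) - k) * (((j : ℕ) + 1).choose ((k : ℕ) + 1) : R)
  have hU : U.det = 1 := by
    rw [Matrix.det_of_isUpperTriangular]
    · simp [U]
    · intro k j hjk
      have h : (j : ℕ) + 1 < (k : ℕ) + 1 := Nat.succ_lt_succ hjk
      simp [U, Nat.choose_eq_zero_of_lt h]
  have hmul : (Matrix.of fun i j : Fin n =>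
      (A i + t) ^ ((j : ℕ) + 1) - (B i + t) ^ ((j : ℕ) + 1)) =
      (Matrix.of fun i j : Fin n => A i ^ ((j : ℕ) + 1) - B i ^ ((j : ℕ) + 1)) * U := by
    ext i j
    simp only [Matrix.mul_apply, Matrix.of_apply, U, sub_mul, Finset.sum_sub_distrib,
      add_pow_succ_eq_sum_fin_add, add_sub_add_right_eq_sub]
  rw [hmul, Matrix.det_mul, hU, mul_one]
end
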